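/- arXiv:2604.19910 — 2 statements merged into one kernel-verified Lean document; each statement's English description precedes it below -/
import Mathlib

section
/- Let φ : ℝ → (−∞,+∞] be proper, even, convex, lower semicontinuous, differentiable on the interior of its domain, with φ(ξ) = 0 if and only if ξ = 0, and satisfying either (i) dom φ = ℝ with φ′(ξ) → ±∞ as ξ → ±∞, or (ii) dom φ = [−a, a] for some a > 0 with φ′(ξ) → ±∞ as ξ → ±a. Let F : ℝ → (−∞,+∞] be lower semicontinuous convex with interior of dom F equal to (0,+∞), F differentiable on (0,+∞), and L₀ := lim_{ξ↓0} F′(ξ) ∈ ℝ ∪ {−∞}. Let Φ be the perspective function of φ∘|·| (Φ(ρ,m) = ρ·φ(|m|/ρ) for ρ > 0, Φ(0,0) = 0, +∞ otherwise) and Ψ(ρ,m) = F(ρ). Fix γ > 0 and (ρ,m) ∈ ℝ × ℝ^d with ρ + γφ*(|m|/γ) > γL₀. Let θ > 0 be the unique solution of θ + γF′(θ) − ρ − γφ*(Prox_{(θ/γ)φ*}(|m|/γ)) = 0, and set v = (1 − (γ/|m|)·Prox_{(θ/γ)φ*}(|m|/γ))·m if m ≠ 0 and v = 0 if m = 0.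 Then (θ,v) is the unique minimizer of (σ,u) ↦ γ(Φ(σ,u) + Ψ(σ,u)) + (1/2)|(σ,u) − (ρ,m)|², i.e. (θ,v) = Prox_{γ(Φ+Ψ)}(ρ,m). -/
open Filter Topology
open scoped Classical

-- Fenchel conjugate of an extended-real-valued function on ℝ.
noncomputable def fconj (φ : ℝ → EReal) (s : ℝ) : EReal :=
  ⨆ ξ : ℝ, ((s * ξ : ℝ) : EReal) - φ ξ

-- The perspective function of `φ ∘ |·|` on `ℝ × ℝ^d`.
noncomputable def persp {d : ℕ} (φ : ℝ → EReal) (p : ℝ × EuclideanSpace ℝ (Fin d)) : EReal :=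
  if 0 < p.1 then (p.1 : EReal) * φ (‖p.2‖ / p.1)
  else if p.1 = 0 ∧ p.2 = 0 then 0 else ⊤

-- `IsProx1 f x p` : `p` is a minimizer of `y ↦ f y + (1/2)(y - x)²`.
def IsProx1 (f : ℝ → EReal) (x p : ℝ) : Prop :=
  ∀ y : ℝ, f p + (((1/2) * (p - x)^2 : ℝ) : EReal) ≤ f y + (((1/2) * (y - x)^2 : ℝ) : EReal)

-- `IsProxP f x z` : `z` is a minimizer of `y ↦ f y + (1/2)|y - x|²` (Euclidean norm on ℝ × ℝ^d).
def IsProxP {d : ℕ} (f : ℝ × EuclideanSpace ℝ (Fin d) → EReal)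
    (x z : ℝ × EuclideanSpace ℝ (Fin d)) : Prop :=
  ∀ y : ℝ × EuclideanSpace ℝ (Fin d),
    f z + (((1/2) * ((z.1 - x.1)^2 + ‖z.2 - x.2‖^2) : ℝ) : EReal) ≤
      f y + (((1/2) * ((y.1 - x.1)^2 + ‖y.2 - x.2‖^2) : ℝ) : EReal)


lemma aux_subgrad (φ : ℝ → EReal) (hbot : ∀ x, φ x ≠ ⊥)
    (hconv : ∀ x y t : ℝ, 0 ≤ t → t ≤ 1 →
      φ (t * x + (1 - t) * y) ≤ (t : EReal) * φ x + ((1 - t : ℝ) : EReal) * φ y)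
    (x D : ℝ) (hx : φ x ≠ ⊤) (hD : HasDerivAt (fun y => (φ y).toReal) D x) (y : ℝ) :
    (((φ x).toReal + D * (y - x) : ℝ) : EReal) ≤ φ y := by
  by_cases hy : φ y = ⊤
  · rw [hy]; exact le_top
  have ex : φ x = ((φ x).toReal : EReal) := (EReal.coe_toReal hx (hbot x)).symm
  have ey : φ y = ((φ y).toReal : EReal) := (EReal.coe_toReal hy (hbot y)).symm
  rw [ey]
  rw [EReal.coe_le_coe_iff]
  have h1 : HasDerivAt (fun t : ℝ => (φ (x + t * (y - x))).toReal) (D * (y - x)) 0 := by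
    have h2 : HasDerivAt (fun t : ℝ => x + t * (y - x)) (1 * (y - x)) 0 :=
      ((hasDerivAt_id (0:ℝ)).mul_const (y - x)).const_add x
    rw [one_mul] at h2
    have h3 : HasDerivAt (fun y => (φ y).toReal) D (x + 0 * (y - x)) := by simpa using hD
    exact h3.comp (0:ℝ) h2
  have h4 := h1.tendsto_slope_zero_right
  have h5 : D * (y - x) ≤ (φ y).toReal - (φ x).toReal := by
    refine le_of_tendsto h4 ?_
    have : Set.Ioc (0:ℝ) 1 ∈ 𝓝[>] (0:ℝ) := Ioc_mem_nhdsGT one_pos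
    filter_upwards [this] with t ht
    have hc := hconv y x t ht.1.le ht.2
    rw [ex, ey, ← EReal.coe_mul, ← EReal.coe_mul, ← EReal.coe_add] at hc
    have e1 : t * y + (1 - t) * x = x + t * (y - x) := by ring
    rw [e1] at hc
    have hc2 := EReal.toReal_le_toReal hc (hbot _) (EReal.coe_ne_top _)
    rw [EReal.toReal_coe] at hc2
    simp only [zero_add, zero_mul, add_zero, smul_eq_mul]
    rw [inv_mul_le_iff₀ ht.1]
    linarith
  linarith

lemma aux_young (φ : ℝ → EReal) (hbot : ∀ x, φ x ≠ ⊥) (P g : ℝ) (hg : fconj φ P = (g : EReal))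
    (ξ : ℝ) : ((P * ξ - g : ℝ) : EReal) ≤ φ ξ := by
  have h : ((P * ξ : ℝ) : EReal) - φ ξ ≤ (g : EReal) := by
    rw [← hg]; exact le_iSup (fun ξ : ℝ => ((P * ξ : ℝ) : EReal) - φ ξ) ξ
  by_cases hy : φ ξ = ⊤
  · rw [hy]; exact le_top
  have ey : φ ξ = ((φ ξ).toReal : EReal) := (EReal.coe_toReal hy (hbot ξ)).symm
  rw [ey] at h ⊢
  rw [← EReal.coe_sub, EReal.coe_le_coe_iff] at h
  rw [EReal.coe_le_coe_iff]
  linarith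

lemma aux_fconj_le (φ : ℝ → EReal) (hbot : ∀ x, φ x ≠ ⊥) (s g : ℝ)
    (h : ∀ ξ, ((s * ξ - g : ℝ) : EReal) ≤ φ ξ) : fconj φ s ≤ (g : EReal) := by
  refine iSup_le fun ξ => ?_
  by_cases hy : φ ξ = ⊤
  · rw [hy]; simp
  have ey : φ ξ = ((φ ξ).toReal : EReal) := (EReal.coe_toReal hy (hbot ξ)).symm
  have h := h ξ
  rw [ey] at h ⊢
  rw [EReal.coe_le_coe_iff] at h
  rw [← EReal.coe_sub, EReal.coe_le_coe_iff]
  linarith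

lemma aux_fconj_nonneg (φ : ℝ → EReal) (h0 : φ 0 = 0) (s : ℝ) : 0 ≤ fconj φ s := by
  have := le_iSup (fun ξ : ℝ => ((s * ξ : ℝ) : EReal) - φ ξ) 0
  have e : ((s * 0 : ℝ) : EReal) - φ 0 = 0 := by simp [h0]
  exact e.symm.le.trans this

/-- optimality of the prox of the conjugate -/
lemma aux_opt (φ : ℝ → EReal) (hbot : ∀ x, φ x ≠ ⊥) (x P τ g : ℝ) (hτ : 0 < τ)
    (hP : IsProx1 (fun y => (τ : EReal) * fconj φ y) x P) (hg : fconj φ P = (g : EReal))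
    (y b : ℝ) (hb : fconj φ y ≤ (b : EReal)) (hb' : fconj φ y = (b : EReal)) :
    g + (x - P) / τ * (y - P) ≤ b := by
  have key : ∀ t : ℝ, 0 < t → t ≤ 1 → (x - P) * (y - P) - τ * (b - g) ≤ t * ((y - P)^2 / 2) := by
    intro t ht ht1
    have h1 : fconj φ (P + t * (y - P)) ≤ ((g + t * (b - g) : ℝ) : EReal) := by
      apply aux_fconj_le φ hbot
      intro ξ
      have a1 := aux_young φ hbot P g hg ξ
      have a2 := aux_young φ hbot y b hb' ξ
      by_cases hy : φ ξ = ⊤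
      · rw [hy]; exact le_top
      have ey : φ ξ = ((φ ξ).toReal : EReal) := (EReal.coe_toReal hy (hbot ξ)).symm
      rw [ey, EReal.coe_le_coe_iff] at a1 a2
      rw [ey, EReal.coe_le_coe_iff]
      have := mul_le_mul_of_nonneg_left a1 (sub_nonneg.2 ht1)
      have := mul_le_mul_of_nonneg_left a2 ht.le
      linarith
    have h2 := hP (P + t * (y - P))
    simp only [hg] at h2
    have h3 : (τ : EReal) * fconj φ (P + t * (y - P)) ≤ (τ : EReal) * ((g + t * (b - g) : ℝ) : EReal) :=
      mul_le_mul_of_nonneg_left h1 (by exact_mod_cast hτ.le)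
    have h4 := h2.trans (add_le_add_left h3 _)
    rw [← EReal.coe_mul, ← EReal.coe_mul, ← EReal.coe_add, ← EReal.coe_add,
      EReal.coe_le_coe_iff] at h4
    have h5 : t * ((x - P) * (y - P) - τ * (b - g)) ≤ t * (t * ((y - P)^2 / 2)) := by
      nlinarith [h4]
    exact le_of_mul_le_mul_left h5 ht
  have h0 : (x - P) * (y - P) - τ * (b - g) ≤ 0 := by
    have ht : Tendsto (fun t : ℝ => t * ((y - P)^2 / 2)) (𝓝[>] 0) (𝓝 0) := by
      have : Tendsto (fun t : ℝ => t * ((y - P)^2 / 2)) (𝓝 0) (𝓝 (0 * ((y - P)^2 / 2))) :=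
        tendsto_id.mul_const _
      rw [zero_mul] at this
      exact this.mono_left nhdsWithin_le_nhds
    refine ge_of_tendsto ht ?_
    filter_upwards [Ioc_mem_nhdsGT (one_pos : (0:ℝ) < 1)] with t h
    exact key t h.1 h.2
  have : (x - P) / τ * (y - P) = ((x - P) * (y - P)) / τ := by ring
  rw [this]
  have : ((x - P) * (y - P)) / τ ≤ b - g := by
    rw [div_le_iff₀ hτ]; linarith
  linarith

lemma aux_lsc (φ : ℝ → EReal) (hlsc : LowerSemicontinuous φ) (w c : ℝ) (l : Filter ℝ) [l.NeBot]
    (hl : l ≤ 𝓝 w) (h : ∀ᶠ x in l, φ x ≤ (c : EReal)) : φ w ≤ (c : EReal) := by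
  by_contra hc
  push Not at hc
  have h1 := (hlsc w c hc).filter_mono hl
  obtain ⟨x, hx1, hx2⟩ := (h1.and h).exists
  exact absurd hx1 (not_lt.2 hx2)

/-- Fenchel equality -/
lemma aux_fenchel (φ : ℝ → EReal) (φ' : ℝ → ℝ)
    (hbot : ∀ x, φ x ≠ ⊥)
    (hconv : ∀ x y t : ℝ, 0 ≤ t → t ≤ 1 →
      φ (t * x + (1 - t) * y) ≤ (t : EReal) * φ x + ((1 - t : ℝ) : EReal) * φ y)
    (hlsc : LowerSemicontinuous φ)
    (hpos : ∀ x, 0 ≤ φ x)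
    (h00 : φ 0 = 0)
    (hdiff : ∀ x ∈ interior {x : ℝ | φ x ≠ ⊤}, HasDerivAt (fun y => (φ y).toReal) (φ' x) x)
    (hcase :
      ({x : ℝ | φ x ≠ ⊤} = Set.univ ∧ Tendsto φ' atBot atBot ∧ Tendsto φ' atTop atTop) ∨
      (∃ a : ℝ, 0 < a ∧ {x : ℝ | φ x ≠ ⊤} = Set.Icc (-a) a ∧
        Tendsto φ' (𝓝[>] (-a)) atBot ∧ Tendsto φ' (𝓝[<] a) atTop))
    (P g w : ℝ)
    (hw : ∀ y b : ℝ, fconj φ y = (b : EReal) → g + w * (y - P) ≤ b) :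
    φ w ≤ ((w * P - g : ℝ) : EReal) := by
  have hint : ∀ x ∈ interior {x : ℝ | φ x ≠ ⊤},
      (φ x).toReal + φ' x * (w - x) ≤ w * P - g := by
    intro x hx
    have hxt : φ x ≠ ⊤ := interior_subset hx
    have ex : φ x = ((φ x).toReal : EReal) := (EReal.coe_toReal hxt (hbot x)).symm
    have h1 : fconj φ (φ' x) = ((φ' x * x - (φ x).toReal : ℝ) : EReal) := by
      apply le_antisymm
      · apply aux_fconj_le φ hbot
        intro ξ
        have := aux_subgrad φ hbot hconv x (φ' x) hxt (hdiff x hx) ξ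
        convert this using 2
        ring
      · have := le_iSup (fun ξ : ℝ => ((φ' x * ξ : ℝ) : EReal) - φ ξ) x
        rw [EReal.coe_sub, ← ex]
        exact this
    have := hw _ _ h1
    linarith
  rcases hcase with ⟨hdom, -, -⟩ | ⟨a, ha, hdom, hL, hR⟩
  · have hwi : w ∈ interior {x : ℝ | φ x ≠ ⊤} := by rw [hdom]; simp
    have := hint w hwi
    have ex : φ w = ((φ w).toReal : EReal) :=
      (EReal.coe_toReal (interior_subset hwi) (hbot w)).symm
    rw [ex, EReal.coe_le_coe_iff]; simpa using this
  · have hbd : ∀ y b : ℝ, |y| * a ≤ b → g + w * (y - P) ≤ b := by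
      intro y b hb
      have h1 : fconj φ y ≤ (b : EReal) := by
        apply aux_fconj_le φ hbot
        intro ξ
        by_cases hξ : φ ξ = ⊤
        · rw [hξ]; exact le_top
        have hm : ξ ∈ Set.Icc (-a) a := by rw [← hdom]; exact hξ
        have : |ξ| ≤ a := abs_le.2 hm
        have h2 : y * ξ ≤ |y| * a := by
          calc y * ξ ≤ |y * ξ| := le_abs_self _
            _ = |y| * |ξ| := abs_mul _ _
            _ ≤ _ := by gcongr
        refine le_trans ?_ (hpos ξ)
        rw [← EReal.coe_zero, EReal.coe_le_coe_iff]; linarith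
      have h0 := aux_fconj_nonneg φ h00 y
      have hnt : fconj φ y ≠ ⊤ := ne_top_of_le_ne_top (EReal.coe_ne_top _) h1
      have hnb : fconj φ y ≠ ⊥ := ne_bot_of_le_ne_bot EReal.zero_ne_bot h0
      have e := (EReal.coe_toReal hnt hnb).symm
      have := hw y _ e
      rw [e, EReal.coe_le_coe_iff] at h1
      linarith
    have hwa : w ≤ a := by
      by_contra hc
      push Not at hc
      set K := (|w * P - g| + 1) / (w - a) with hK
      have hKp : 0 < K := by apply div_pos <;> [positivity; linarith]
      have := hbd K _ le_rfl
      rw [abs_of_pos hKp] at this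
      have hk : K * (w - a) = |w * P - g| + 1 := by
        rw [hK]; field_simp [sub_ne_zero.2 hc.ne']
      have := le_abs_self (w * P - g)
      nlinarith
    have hwa' : -a ≤ w := by
      by_contra hc
      push Not at hc
      set K := (|w * P - g| + 1) / (-a - w) with hK
      have hKp : 0 < K := by apply div_pos <;> [positivity; linarith]
      have := hbd (-K) _ le_rfl
      rw [abs_neg, abs_of_pos hKp] at this
      have hk : K * (-a - w) = |w * P - g| + 1 := by
        rw [hK]; field_simp [sub_ne_zero.2 hc.ne']
      have := le_abs_self (w * P - g)
      nlinarith
    have hI : interior {x : ℝ | φ x ≠ ⊤} = Set.Ioo (-a) a := by rw [hdom, interior_Icc]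
    have hfin : ∀ x ∈ Set.Ioo (-a) a, 0 ≤ φ' x * (w - x) → φ x ≤ ((w * P - g : ℝ) : EReal) := by
      intro x hx h0
      rw [← hI] at hx
      have := hint x hx
      have ex : φ x = ((φ x).toReal : EReal) :=
        (EReal.coe_toReal (interior_subset hx) (hbot x)).symm
      rw [ex, EReal.coe_le_coe_iff]; linarith
    rcases eq_or_lt_of_le hwa with h | h
    · apply aux_lsc φ hlsc w _ (𝓝[<] w) nhdsWithin_le_nhds
      subst h
      filter_upwards [hR.eventually_ge_atTop 0, Ioo_mem_nhdsLT (show -w < w by linarith)] with x h1 h2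
      exact hfin x h2 (mul_nonneg h1 (by linarith [h2.2]))
    rcases eq_or_lt_of_le hwa' with h' | h'
    · apply aux_lsc φ hlsc w _ (𝓝[>] w) nhdsWithin_le_nhds
      rw [h'] at hL
      filter_upwards [hL.eventually_le_atBot 0, Ioo_mem_nhdsGT h] with x h1 h2
      exact hfin x ⟨by linarith [h2.1], h2.2⟩ (mul_nonneg_of_nonpos_of_nonpos h1 (by linarith [h2.1]))
    · exact hfin w ⟨h', h⟩ (by simp)

/-- if `ρ + γφ*(|m|/γ) > γL₀`, `θ > 0` solves
`θ + γF′(θ) − ρ − γφ*(Prox_{(θ/γ)φ*}(|m|/γ)) = 0`, and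
`v = (1 − (γ/|m|)Prox_{(θ/γ)φ*}(|m|/γ))·m` (with `v = 0` when `m = 0`),
then `(θ,v) = Prox_{γ(Φ+Ψ)}(ρ,m)`, the unique minimizer of
`(σ,u) ↦ γ(Φ(σ,u) + Ψ(σ,u)) + (1/2)|(σ,u) − (ρ,m)|²`. -/
theorem prox_formula_general
    (d : ℕ) (hd : 1 ≤ d)
    (φ : ℝ → EReal) (φ' : ℝ → ℝ)
    (hbot : ∀ x, φ x ≠ ⊥)
    (hproper : ∃ x, φ x ≠ ⊤)
    (heven : ∀ x, φ (-x) = φ x)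
    (hconv : ∀ x y t : ℝ, 0 ≤ t → t ≤ 1 →
      φ (t * x + (1 - t) * y) ≤ (t : EReal) * φ x + ((1 - t : ℝ) : EReal) * φ y)
    (hlsc : LowerSemicontinuous φ)
    (hdiff : ∀ x ∈ interior {x : ℝ | φ x ≠ ⊤}, HasDerivAt (fun y => (φ y).toReal) (φ' x) x)
    (hzero : ∀ x, φ x = 0 ↔ x = 0)
    (hcase :
      ({x : ℝ | φ x ≠ ⊤} = Set.univ ∧ Tendsto φ' atBot atBot ∧ Tendsto φ' atTop atTop) ∨
      (∃ a : ℝ, 0 < a ∧ {x : ℝ | φ x ≠ ⊤} = Set.Icc (-a) a ∧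
        Tendsto φ' (𝓝[>] (-a)) atBot ∧ Tendsto φ' (𝓝[<] a) atTop))
    (F : ℝ → EReal) (F' : ℝ → ℝ)
    (hFbot : ∀ x, F x ≠ ⊥)
    (hFlsc : LowerSemicontinuous F)
    (hFconv : ∀ x y t : ℝ, 0 ≤ t → t ≤ 1 →
      F (t * x + (1 - t) * y) ≤ (t : EReal) * F x + ((1 - t : ℝ) : EReal) * F y)
    (hFdom : interior {x : ℝ | F x ≠ ⊤} = Set.Ioi 0)
    (hFdiff : ∀ x : ℝ, 0 < x → HasDerivAt (fun y => (F y).toReal) (F' x) x)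
    (L₀ : EReal) (hL0top : L₀ ≠ ⊤)
    (hL0 : Tendsto (fun ξ : ℝ => (F' ξ : EReal)) (𝓝[>] 0) (𝓝 L₀))
    (γ : ℝ) (hγ : 0 < γ) (ρ : ℝ) (m : EuclideanSpace ℝ (Fin d))
    (hcond : (γ : EReal) * L₀ < (ρ : EReal) + (γ : EReal) * fconj φ (‖m‖ / γ))
    (θ : ℝ) (hθ : 0 < θ)
    -- `P = Prox_{(θ/γ)φ*}(|m|/γ)`
    (P : ℝ)
    (hP : IsProx1 (fun y => ((θ / γ : ℝ) : EReal) * fconj φ y) (‖m‖ / γ) P)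
    (hroot : θ + γ * F' θ - ρ - γ * (fconj φ P).toReal = 0)
    (v : EuclideanSpace ℝ (Fin d))
    (hv : v = if m = 0 then 0 else (1 - (γ / ‖m‖) * P) • m) :
    IsProxP (fun z => (γ : EReal) * (persp φ z + F z.1)) (ρ, m) (θ, v) ∧
    ∀ z, IsProxP (fun z => (γ : EReal) * (persp φ z + F z.1)) (ρ, m) z → z = (θ, v) := by
  have h00 : φ 0 = 0 := (hzero 0).2 rfl
  have hpos : ∀ x, 0 ≤ φ x := by
    intro x
    by_cases hx : φ x = ⊤
    · rw [hx]; exact le_top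
    have ex : φ x = ((φ x).toReal : EReal) := (EReal.coe_toReal hx (hbot x)).symm
    have h := hconv x (-x) (1/2) (by norm_num) (by norm_num)
    have e0 : (1/2 : ℝ) * x + (1 - 1/2) * (-x) = 0 := by ring
    rw [e0, h00, heven, ex, ← EReal.coe_mul, ← EReal.coe_mul, ← EReal.coe_add, ← EReal.coe_zero,
      EReal.coe_le_coe_iff] at h
    rw [ex, ← EReal.coe_zero, EReal.coe_le_coe_iff]
    linarith
  have hg0 : fconj φ 0 = 0 := by
    apply le_antisymm _ (aux_fconj_nonneg φ h00 0)
    have := aux_fconj_le φ hbot 0 0 (fun ξ => by simpa using hpos ξ)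
    simpa using this
  have hτ : 0 < θ / γ := div_pos hθ hγ
  have hgt : fconj φ P ≠ ⊤ := by
    intro h
    have h1 := hP 0
    simp only [h, hg0, mul_zero, zero_add] at h1
    rw [EReal.coe_mul_top_of_pos hτ, EReal.top_add_coe] at h1
    exact absurd h1 (not_le.2 (EReal.coe_lt_top _))
  have hgb : fconj φ P ≠ ⊥ := ne_bot_of_le_ne_bot EReal.zero_ne_bot (aux_fconj_nonneg φ h00 P)
  obtain ⟨g, hg⟩ : ∃ g : ℝ, fconj φ P = (g : EReal) := ⟨_, (EReal.coe_toReal hgt hgb).symm⟩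
  have hg_nonneg : 0 ≤ g := by
    have := aux_fconj_nonneg φ h00 P
    rw [hg] at this; exact_mod_cast this
  rw [hg, EReal.toReal_coe] at hroot
  obtain ⟨w, hwdef⟩ : ∃ w, w = (‖m‖ / γ - P) / (θ / γ) := ⟨_, rfl⟩
  have hθw : θ * w = ‖m‖ - γ * P := by rw [hwdef]; field_simp
  have hopt : ∀ y b : ℝ, fconj φ y = (b : EReal) → g + w * (y - P) ≤ b := by
    intro y b hb
    rw [hwdef]
    exact aux_opt φ hbot (‖m‖ / γ) P (θ / γ) g hτ hP hg y b hb.le hb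
  have hFe := aux_fenchel φ φ' hbot hconv hlsc hpos h00 hdiff hcase P g w hopt
  have hFe2 := aux_young φ hbot P g hg w
  have hφw : φ w = ((w * P - g : ℝ) : EReal) := by
    apply le_antisymm hFe
    rw [mul_comm w P]; exact hFe2
  have hm0 : m = 0 → P = 0 := by
    intro h
    have h1 := hP 0
    simp only [hg, hg0, h, norm_zero, zero_div, mul_zero, zero_add, sub_zero] at h1
    rw [← EReal.coe_mul, ← EReal.coe_add, EReal.coe_le_coe_iff] at h1
    have : 0 ≤ θ / γ * g := mul_nonneg hτ.le hg_nonneg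
    have : P ^ 2 = 0 := by nlinarith [sq_nonneg P]
    simpa using this
  obtain ⟨p, hp1, hp2, hp3, hp4⟩ : ∃ p : EuclideanSpace ℝ (Fin d), m - v = γ • p ∧
      ‖p‖ ≤ |P| ∧ inner ℝ p v = P * (θ * w) ∧ ‖v‖ = θ * |w| := by
    by_cases h : m = 0
    · have hP0 := hm0 h
      have hw0 : w = 0 := by
        rw [hwdef, hP0, h]; simp
      refine ⟨0, ?_, ?_, ?_, ?_⟩ <;> simp [hv, h, hP0, hw0]
    · have hn : ‖m‖ ≠ 0 := norm_ne_zero_iff.2 h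
      have hv' : v = ((θ * w) / ‖m‖) • m := by
        rw [hv, if_neg h, hθw]; congr 1; field_simp
      refine ⟨(P / ‖m‖) • m, ?_, ?_, ?_, ?_⟩
      · rw [hv, if_neg h, smul_smul, sub_smul, one_smul, sub_sub_cancel]
        congr 1; ring
      · rw [norm_smul, Real.norm_eq_abs, abs_div, abs_norm]
        exact (div_mul_cancel₀ _ hn).le
      · rw [hv', inner_smul_left, inner_smul_right, real_inner_self_eq_norm_sq]
        simp only [conj_trivial]
        field_simp
      · rw [hv', norm_smul, Real.norm_eq_abs, abs_div, abs_norm, div_mul_cancel₀ _ hn, abs_mul,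
          abs_of_pos hθ]
  have hper : ∀ y : ℝ × EuclideanSpace ℝ (Fin d),
      ((inner ℝ p y.2 - g * y.1 : ℝ) : EReal) ≤ persp φ y := by
    rintro ⟨σ, u⟩
    unfold persp
    simp only
    split_ifs with h1 h2
    · have hy : ((|P| * (‖u‖ / σ) - g : ℝ) : EReal) ≤ φ (‖u‖ / σ) := by
        rcases abs_cases P with ⟨h, -⟩ | ⟨h, -⟩
        · rw [h]; exact aux_young φ hbot P g hg _
        · rw [h, ← heven]
          have := aux_young φ hbot P g hg (-(‖u‖ / σ))
          rwa [mul_neg, ← neg_mul] at this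
      have h3 := mul_le_mul_of_nonneg_left hy (show (0 : EReal) ≤ (σ : EReal) by exact_mod_cast h1.le)
      refine le_trans ?_ h3
      rw [← EReal.coe_mul, EReal.coe_le_coe_iff]
      have h4 : inner ℝ p u ≤ |P| * ‖u‖ :=
        (real_inner_le_norm p u).trans (mul_le_mul_of_nonneg_right hp2 (norm_nonneg _))
      have h5 : σ * (|P| * (‖u‖ / σ) - g) = |P| * ‖u‖ - g * σ := by field_simp
      rw [h5]; linarith
    · rw [h2.1, h2.2]; simp
    · exact le_top
  have hFt : F θ ≠ ⊤ := by
    have : θ ∈ interior {x : ℝ | F x ≠ ⊤} := by rw [hFdom]; exact hθ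
    exact interior_subset this
  have hFsub := aux_subgrad F hFbot hFconv θ (F' θ) hFt (hFdiff θ hθ)
  have eF : F θ = ((F θ).toReal : EReal) := (EReal.coe_toReal hFt (hFbot θ)).symm
  obtain ⟨c, hc⟩ : ∃ c, c = (F θ).toReal := ⟨_, rfl⟩
  rw [← hc] at eF hFsub
  have hpz : persp φ (θ, v) = ((θ * (w * P - g) : ℝ) : EReal) := by
    unfold persp
    simp only [if_pos hθ]
    have : φ (‖v‖ / θ) = φ w := by
      rw [hp4, mul_div_cancel_left₀ _ hθ.ne']
      rcases abs_cases w with ⟨h, -⟩ | ⟨h, -⟩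
      · rw [h]
      · rw [h, heven]
    rw [this, hφw, ← EReal.coe_mul]
  obtain ⟨E, hE⟩ : ∃ E : ℝ, E = γ * (θ * (w * P - g) + c) +
    (1/2) * ((θ - ρ)^2 + ‖v - m‖^2) := ⟨_, rfl⟩
  have hval : (γ : EReal) * (persp φ (θ, v) + F θ) +
      (((1/2) * ((θ - ρ)^2 + ‖v - m‖^2) : ℝ) : EReal) = (E : EReal) := by
    rw [hpz, eF, ← EReal.coe_add, ← EReal.coe_mul, ← EReal.coe_add, hE]
  have hstrong : ∀ y : ℝ × EuclideanSpace ℝ (Fin d),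
      ((E + (1/2) * ((y.1 - θ)^2 + ‖y.2 - v‖^2) : ℝ) : EReal) ≤
      (γ : EReal) * (persp φ y + F y.1) +
      (((1/2) * ((y.1 - ρ)^2 + ‖y.2 - m‖^2) : ℝ) : EReal) := by
    intro y
    have h1 := add_le_add (hper y) (hFsub y.1)
    have h2 := mul_le_mul_of_nonneg_left h1 (show (0 : EReal) ≤ (γ : EReal) by exact_mod_cast hγ.le)
    refine le_trans ?_ (add_le_add_left h2 _)
    rw [← EReal.coe_add, ← EReal.coe_mul, ← EReal.coe_add, EReal.coe_le_coe_iff]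
    apply le_of_eq
    have hm : m = v + γ • p := by rw [← hp1]; abel
    have n1 : ‖y.2 - m‖^2 = ‖y.2 - v‖^2 - 2 * (γ * (inner ℝ p y.2 - P * (θ * w))) + ‖v - m‖^2 := by
      have e1 : y.2 - m = (y.2 - v) - γ • p := by rw [hm]; abel
      have e2 : v - m = - (γ • p) := by rw [hm]; abel
      rw [e1, e2, norm_neg, norm_sub_sq_real, inner_smul_right, inner_sub_left,
        real_inner_comm, real_inner_comm p v, hp3]
    rw [n1, hE]
    have hρ : ρ = θ + γ * F' θ - γ * g := by linarith
    rw [hρ]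
    ring
  constructor
  · intro y
    simp only
    rw [hval]
    refine le_trans ?_ (hstrong y)
    rw [EReal.coe_le_coe_iff]
    have : 0 ≤ (1/2 : ℝ) * ((y.1 - θ)^2 + ‖y.2 - v‖^2) := by positivity
    linarith
  · intro z hz
    have h1 := hz (θ, v)
    simp only at h1
    rw [hval] at h1
    have h2 := (hstrong z).trans h1
    rw [EReal.coe_le_coe_iff] at h2
    have a1 : (z.1 - θ)^2 = 0 := by nlinarith [sq_nonneg (z.1 - θ), sq_nonneg ‖z.2 - v‖]
    have a2 : ‖z.2 - v‖^2 = 0 := by nlinarith [sq_nonneg (z.1 - θ), sq_nonneg ‖z.2 - v‖]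
    ext1
    · exact sub_eq_zero.1 (by simpa using a1)
    · exact sub_eq_zero.1 (by simpa using a2)
end

section
/- Let φ : ℝ → (−∞,+∞] be proper, even, convex, lower semicontinuous, differentiable on the interior of its domain, with φ(ξ) = 0 if and only if ξ = 0, and satisfying either (i) dom φ = ℝ with φ′(ξ) → ±∞ as ξ → ±∞, or (ii) dom φ = [−a, a] for some a > 0 with φ′(ξ) → ±∞ as ξ → ±a. Let F : ℝ → (−∞,+∞] be lower semicontinuous convex with interior of dom F equal to (0,+∞), F differentiable on (0,+∞), and L₀ := lim_{ξ↓0} F′(ξ) ∈ ℝ ∪ {−∞}. Let Φ be the perspective function of φ∘|·| and Ψ(ρ,m) = F(ρ). Fix γ > 0, (ρ,m) ∈ ℝ × ℝ^d, and θ > 0. Then (θ, 0) is the unique minimizer of (σ,u) ↦ γ(Φ(σ,u) + Ψ(σ,u)) + (1/2)|(σ,u) − (ρ,m)|² if and only if m = 0 and θ = Prox_{γF}(ρ). -/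
open Filter Topology
open scoped Classical

/-- for `θ > 0`, the point `(θ, 0)` is the unique minimizer of
`(σ,u) ↦ γ(Φ(σ,u) + Ψ(σ,u)) + (1/2)|(σ,u) − (ρ,m)|²` if and only if
`m = 0` and `θ = Prox_{γF}(ρ)`. -/
theorem prox_on_axis_iff
    (d : ℕ) (hd : 1 ≤ d)
    (φ : ℝ → EReal) (φ' : ℝ → ℝ)
    (hbot : ∀ x, φ x ≠ ⊥)
    (hproper : ∃ x, φ x ≠ ⊤)
    (heven : ∀ x, φ (-x) = φ x)
    (hconv : ∀ x y t : ℝ, 0 ≤ t → t ≤ 1 →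
      φ (t * x + (1 - t) * y) ≤ (t : EReal) * φ x + ((1 - t : ℝ) : EReal) * φ y)
    (hlsc : LowerSemicontinuous φ)
    (hdiff : ∀ x ∈ interior {x : ℝ | φ x ≠ ⊤}, HasDerivAt (fun y => (φ y).toReal) (φ' x) x)
    (hzero : ∀ x, φ x = 0 ↔ x = 0)
    (hcase :
      ({x : ℝ | φ x ≠ ⊤} = Set.univ ∧ Tendsto φ' atBot atBot ∧ Tendsto φ' atTop atTop) ∨
      (∃ a : ℝ, 0 < a ∧ {x : ℝ | φ x ≠ ⊤} = Set.Icc (-a) a ∧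
        Tendsto φ' (𝓝[>] (-a)) atBot ∧ Tendsto φ' (𝓝[<] a) atTop))
    (F : ℝ → EReal) (F' : ℝ → ℝ)
    (hFbot : ∀ x, F x ≠ ⊥)
    (hFlsc : LowerSemicontinuous F)
    (hFconv : ∀ x y t : ℝ, 0 ≤ t → t ≤ 1 →
      F (t * x + (1 - t) * y) ≤ (t : EReal) * F x + ((1 - t : ℝ) : EReal) * F y)
    (hFdom : interior {x : ℝ | F x ≠ ⊤} = Set.Ioi 0)
    (hFdiff : ∀ x : ℝ, 0 < x → HasDerivAt (fun y => (F y).toReal) (F' x) x)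
    (L₀ : EReal) (hL0top : L₀ ≠ ⊤)
    (hL0 : Tendsto (fun ξ : ℝ => (F' ξ : EReal)) (𝓝[>] 0) (𝓝 L₀))
    (γ : ℝ) (hγ : 0 < γ) (ρ : ℝ) (m : EuclideanSpace ℝ (Fin d))
    (θ : ℝ) (hθ : 0 < θ) :
    (IsProxP (fun z => (γ : EReal) * (persp φ z + F z.1)) (ρ, m) (θ, 0) ∧
      ∀ z, IsProxP (fun z => (γ : EReal) * (persp φ z + F z.1)) (ρ, m) z → z = (θ, 0))
    ↔ (m = 0 ∧ IsProx1 (fun y => (γ : EReal) * F y) ρ θ) := by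
  have hφ0 : φ 0 = 0 := (hzero 0).2 rfl
  have hnn : ∀ x, 0 ≤ φ x := by
    intro x
    by_cases hx : φ x = ⊤
    · rw [hx]; exact le_top
    have h := hconv x (-x) (1/2) (by norm_num) (by norm_num)
    rw [heven x] at h
    have e : (1/2 : ℝ) * x + (1 - 1/2) * (-x) = 0 := by ring
    rw [e, hφ0] at h
    lift φ x to ℝ using ⟨hx, hbot x⟩ with r
    norm_cast at h ⊢
    linarith
  have hP : ∀ z : ℝ × EuclideanSpace ℝ (Fin d), 0 ≤ persp φ z := by
    intro z
    unfold persp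
    split_ifs with h1 h2
    · exact mul_nonneg (by exact_mod_cast h1.le) (hnn _)
    · exact le_rfl
    · exact le_top
  have hP0 : ∀ s : ℝ, 0 ≤ s → persp φ (s, (0 : EuclideanSpace ℝ (Fin d))) = 0 := by
    intro s hs
    unfold persp
    split_ifs with h1 h2
    · simp [hφ0]
    · rfl
    · exact absurd ⟨le_antisymm (not_lt.1 h1) hs, rfl⟩ h2
  have hFpos : ∀ x : ℝ, 0 < x → F x ≠ ⊤ := by
    intro x hx
    have : x ∈ interior {x : ℝ | F x ≠ ⊤} := by rw [hFdom]; exact hx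
    exact interior_subset this
  have hFneg : ∀ x : ℝ, x < 0 → F x = ⊤ := by
    intro x hx
    by_contra hne
    have hsub : Set.Ioo x 1 ⊆ {x : ℝ | F x ≠ ⊤} := by
      intro y hy
      have h := hFconv x 1 ((1 - y) / (1 - x)) (div_nonneg (by linarith [hy.2]) (by linarith))
        ((div_le_one (by linarith)).2 (by linarith [hy.1]))
      have hx1 : (1 : ℝ) - x ≠ 0 := by linarith
      have e : (1 - y) / (1 - x) * x + (1 - (1 - y) / (1 - x)) * 1 = y := by
        field_simp; ring
      rw [e] at h
      intro hy'
      rw [hy'] at h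
      have h1 := hFpos 1 one_pos
      lift F x to ℝ using ⟨hne, hFbot x⟩ with r
      lift F 1 to ℝ using ⟨h1, hFbot 1⟩ with q
      norm_cast at h
    have h2 : x / 2 ∈ interior {x : ℝ | F x ≠ ⊤} :=
      interior_maximal hsub isOpen_Ioo ⟨by linarith, by linarith⟩
    rw [hFdom] at h2
    have : (0:ℝ) < x / 2 := h2
    linarith
  have hγE : (0 : EReal) ≤ (γ : EReal) := by exact_mod_cast hγ.le
  obtain ⟨f, hf⟩ : ∃ f : ℝ, F θ = f :=
    ⟨(F θ).toReal, (EReal.coe_toReal (hFpos θ hθ) (hFbot θ)).symm⟩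
  constructor
  · rintro ⟨hmin, -⟩
    have hm : m = 0 := by
      by_contra hm
      have hM : 0 < ‖m‖ := norm_pos_iff.2 hm
      have h0 : (0 : ℝ) ∈ interior {x : ℝ | φ x ≠ ⊤} := by
        rcases hcase with ⟨h, -⟩ | ⟨a, ha, h, -⟩
        · rw [h]; simp
        · rw [h, interior_Icc]; exact ⟨by linarith, ha⟩
      have hd0 := hdiff 0 h0
      have hz : φ' 0 = 0 := by
        refine IsLocalMin.hasDerivAt_eq_zero (Filter.Eventually.of_forall ?_) hd0
        intro x
        simp only [hφ0, EReal.toReal_zero]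
        exact EReal.toReal_nonneg (hnn x)
      rw [hz] at hd0
      have ho := hd0.isLittleO
      simp only [hφ0, EReal.toReal_zero, sub_zero, smul_zero] at ho
      have hb := ho.bound (show (0:ℝ) < ‖m‖ / (4 * γ) by positivity)
      have hfin : ∀ᶠ x in 𝓝 (0:ℝ), φ x ≠ ⊤ := mem_interior_iff_mem_nhds.1 h0
      have hT : Tendsto (fun t : ℝ => t * ‖m‖ / θ) (𝓝[>] 0) (𝓝 0) := by
        have : Continuous (fun t : ℝ => t * ‖m‖ / θ) := by fun_prop
        have := this.tendsto 0
        simp only [zero_mul, zero_div] at this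
        exact this.mono_left nhdsWithin_le_nhds
      have h1 : ∀ᶠ t in 𝓝[>] (0:ℝ), t < 1 :=
        nhdsWithin_le_nhds (Iio_mem_nhds one_pos)
      obtain ⟨t, ⟨⟨hb, hfin⟩, ht1⟩, ht0⟩ :=
        (((hT.eventually (hb.and hfin)).and h1).and self_mem_nhdsWithin).exists
      have ht0 : 0 < t := ht0
      have h := hmin (θ, t • m)
      have hnorm : ‖t • m‖ = t * ‖m‖ := by rw [norm_smul, Real.norm_of_nonneg ht0.le]
      have e1 : persp φ (θ, t • m) = (θ : EReal) * φ (t * ‖m‖ / θ) := by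
        simp [persp, hθ, hnorm]
      have hn2 : ‖t • m - m‖ = (1 - t) * ‖m‖ := by
        have : t • m - m = -((1 - t) • m) := by rw [sub_smul, one_smul]; abel
        rw [this, norm_neg, norm_smul, Real.norm_of_nonneg (by linarith)]
      simp only [e1, hP0 θ hθ.le, hf, hn2, zero_sub, norm_neg] at h
      have hx0 : 0 ≤ t * ‖m‖ / θ := by positivity
      have hnx := hnn (t * ‖m‖ / θ)
      have hxt : θ * (t * ‖m‖ / θ) = t * ‖m‖ := by field_simp
      generalize t * ‖m‖ / θ = x at *
      obtain ⟨r, hr⟩ : ∃ r : ℝ, φ x = r :=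
        ⟨(φ x).toReal, (EReal.coe_toReal hfin (hbot _)).symm⟩
      rw [hr] at h hnx hb
      simp only [EReal.toReal_coe, Real.norm_eq_abs, abs_of_nonneg hx0] at hb
      norm_cast at h hnx
      have hb := (le_abs_self _).trans hb
      have h6 : γ * (θ * r) ≤ ‖m‖ * (t * ‖m‖) / 4 := by
        calc γ * (θ * r) ≤ γ * (θ * (‖m‖ / (4 * γ) * x)) := by gcongr
          _ = ‖m‖ * (θ * x) / 4 := by field_simp
          _ = _ := by rw [hxt]
      have h7 : 0 < t * ‖m‖ ^ 2 := by positivity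
      have h8 : t * (t * ‖m‖ ^ 2) ≤ 1 * (t * ‖m‖ ^ 2) := by gcongr
      nlinarith
    refine ⟨hm, ?_⟩
    subst hm
    intro y
    rcases lt_or_ge y 0 with hy | hy
    · simp only [hFneg y hy, EReal.coe_mul_top_of_pos hγ, EReal.top_add_coe]
      exact le_top
    · have h := hmin (y, 0)
      simpa [hP0 θ hθ.le, hP0 y hy] using h
  · rintro ⟨rfl, hprox⟩
    have key : ∀ z : ℝ × EuclideanSpace ℝ (Fin d), (γ : EReal) * F z.1 ≤
        (γ : EReal) * (persp φ z + F z.1) := fun z =>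
      mul_le_mul_of_nonneg_left (le_add_of_nonneg_left (hP z)) hγE
    constructor
    · intro y
      have h := hprox y.1
      simp only [hP0 θ hθ.le, zero_add, sub_zero, norm_zero] at h ⊢
      refine le_trans ?_ (le_trans h ?_)
      · apply le_of_eq; congr 3; ring
      · refine add_le_add (key y) ?_
        norm_cast
        nlinarith [sq_nonneg ‖y.2‖]
    · intro z hz
      have h1 := hz (θ, 0)
      have h2 := hprox z.1
      simp only [hP0 θ hθ.le, zero_add, sub_zero, norm_zero, hf] at h1 h2
      have h3 := le_trans (add_le_add_left (key z) _) h1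
      have hne : F z.1 ≠ ⊤ := by
        intro htop
        rw [htop, EReal.coe_mul_top_of_pos hγ, EReal.top_add_coe] at h3
        norm_cast at h3
      obtain ⟨g, hg⟩ : ∃ g : ℝ, F z.1 = g :=
        ⟨(F z.1).toReal, (EReal.coe_toReal hne (hFbot _)).symm⟩
      rw [hg] at h2 h3
      norm_cast at h2 h3
      have hu : ‖z.2‖ = 0 := by
        have : ‖z.2‖ ^ 2 ≤ 0 := by nlinarith
        exact pow_eq_zero_iff (two_ne_zero) |>.1 (le_antisymm this (sq_nonneg _))
      have hc := hFconv z.1 θ (1/2) (by norm_num) (by norm_num)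
      have h4 := hprox (1/2 * z.1 + (1 - 1/2) * θ)
      simp only [hf] at h4
      have h5 := le_trans h4 (add_le_add_left (mul_le_mul_of_nonneg_left hc hγE) _)
      rw [hg, hf] at h5
      norm_cast at h5
      rw [hu] at h3
      have hs : z.1 = θ := by
        have : (z.1 - θ) ^ 2 ≤ 0 := by nlinarith
        have := pow_eq_zero_iff (two_ne_zero) |>.1 (le_antisymm this (sq_nonneg _))
        linarith
      exact Prod.ext hs (norm_eq_zero.1 hu)
end
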